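/- If ε ≤ 1/2, then for every nondecreasing V^0 ∈ 𝒱 the trajectory Φ^n(V^0) converges, as n → ∞, to a fixed point of Φ (i.e., there exists P ∈ 𝒱 with Φ(P) = P and ρ(Φ^n(V^0), P) → 0). -/

import Mathlib

open Finset Filter

/-- `J ε V k` is the set of indices `l` whose opinions are `ε`-close to `V k`. -/
noncomputable def J {N : ℕ} (ε : ℝ) (V : Fin N → ℝ) (k : Fin N) : Finset (Fin N) :=
  Finset.univ.filter (fun l => |V l - V k| ≤ ε)

/-- `w h ε V k = v_k + (h / I(v_k)) · Σ_{l ∈ J(v_k)} v_l`. -/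
noncomputable def w {N : ℕ} (h ε : ℝ) (V : Fin N → ℝ) (k : Fin N) : ℝ :=
  V k + (h / (J ε V k).card) * ∑ l ∈ J ε V k, V l

/-- The opinion-dynamics operator `Φ`, obtained from `w` by cutting at `±1`. -/
noncomputable def Phi {N : ℕ} (h ε : ℝ) (V : Fin N → ℝ) : Fin N → ℝ :=
  fun k => max (-1) (min 1 (w h ε V k))

/-- The metric `ρ(V, V') = max_k |v_k − v'_k|` on `𝒱`. -/
noncomputable def rho {N : ℕ} (V V' : Fin N → ℝ) : ℝ := ⨆ k, |V k - V' k|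

section Operator

variable {N : ℕ} {h ε : ℝ}

/-- The mean opinion over the `ε`-neighbourhood of the agent `k`. -/
noncomputable def localMean (ε : ℝ) (V : Fin N → ℝ) (k : Fin N) : ℝ :=
  (∑ l ∈ J ε V k, V l) / (J ε V k).card

lemma w_eq_add_localMean (V : Fin N → ℝ) (k : Fin N) :
    w h ε V k = V k + h * localMean ε V k := by
  unfold w localMean
  ring

lemma mem_J {V : Fin N → ℝ} {k l : Fin N} : l ∈ J ε V k ↔ |V l - V k| ≤ ε := by
  simp [J]

lemma self_mem_J (hε : 0 ≤ ε) (V : Fin N → ℝ) (k : Fin N) : k ∈ J ε V k := by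
  simp [mem_J, hε]

lemma card_J_pos (hε : 0 ≤ ε) (V : Fin N → ℝ) (k : Fin N) : (0 : ℝ) < (J ε V k).card := by
  exact_mod_cast Finset.card_pos.2 ⟨k, self_mem_J hε V k⟩

lemma card_mul_sum_le_card_mul_sum {ι : Type*} (s t : Finset ι) (f : ι → ℝ)
    (hst : ∀ x ∈ s, ∀ y ∈ t, f x ≤ f y) :
    (t.card : ℝ) * ∑ x ∈ s, f x ≤ s.card * ∑ y ∈ t, f y := by
  have := Finset.sum_le_sum fun x hx => Finset.sum_le_sum fun y hy => hst x hx y hy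
  simpa [← Finset.mul_sum] using this

lemma localMean_le_localMean (hε : 0 ≤ ε) {V : Fin N → ℝ} {k l : Fin N} (hkl : V k ≤ V l) :
    localMean ε V k ≤ localMean ε V l := by
  unfold localMean
  rw [div_le_div_iff₀ (card_J_pos hε V k) (card_J_pos hε V l)]
  set A := J ε V k with hA
  set B := J ε V l with hB
  have lower : ∀ x ∈ A \ B, ∀ y ∈ B, V x ≤ V y := by
    intro x hx y hy
    simp only [hA, hB, Finset.mem_sdiff, mem_J, abs_le, not_and_or, not_le] at hx hy
    rcases hx with ⟨hx, hx' | hx'⟩ <;> linarith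
  have upper : ∀ x ∈ A, ∀ y ∈ B \ A, V x ≤ V y := by
    intro x hx y hy
    simp only [hA, hB, Finset.mem_sdiff, mem_J, abs_le, not_and_or, not_le] at hx hy
    rcases hy with ⟨hy, hy' | hy'⟩ <;> linarith
  have h₁ := card_mul_sum_le_card_mul_sum (A \ B) (B \ A) V
    fun x hx y hy => lower x hx y (Finset.mem_sdiff.1 hy).1
  have h₂ := card_mul_sum_le_card_mul_sum (A \ B) (A ∩ B) V
    fun x hx y hy => lower x hx y (Finset.mem_inter.1 hy).2
  have h₃ := card_mul_sum_le_card_mul_sum (A ∩ B) (B \ A) V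
    fun x hx y hy => upper x (Finset.mem_inter.1 hx).1 y hy
  have sA := Finset.sum_inter_add_sum_sdiff A B V
  have sB := Finset.sum_inter_add_sum_sdiff B A V
  have cA : ((A ∩ B).card : ℝ) + (A \ B).card = A.card := by
    exact_mod_cast Finset.card_inter_add_card_sdiff A B
  have cB : ((B ∩ A).card : ℝ) + (B \ A).card = B.card := by
    exact_mod_cast Finset.card_inter_add_card_sdiff B A
  rw [Finset.inter_comm B A] at sB cB
  rw [← sA, ← sB, ← cA, ← cB]
  linarith

lemma Phi_le_Phi (hh : 0 ≤ h) (hε : 0 ≤ ε) {V : Fin N → ℝ} {k l : Fin N} (hkl : V k ≤ V l) :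
    Phi h ε V k ≤ Phi h ε V l := by
  unfold Phi
  rw [w_eq_add_localMean, w_eq_add_localMean]
  have := localMean_le_localMean hε hkl
  gcongr

lemma iterate_Phi_le_iterate_Phi (hh : 0 ≤ h) (hε : 0 ≤ ε) {V : Fin N → ℝ} {k l : Fin N}
    (hkl : V k ≤ V l) (n : ℕ) : (Phi h ε)^[n] V k ≤ (Phi h ε)^[n] V l := by
  induction n with
  | zero => exact hkl
  | succ n ih =>
    rw [Function.iterate_succ_apply']
    exact Phi_le_Phi hh hε ih

lemma Phi_mem_Icc (V : Fin N → ℝ) (k : Fin N) : Phi h ε V k ∈ Set.Icc (-1 : ℝ) 1 :=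
  ⟨le_max_left _ _, max_le (by norm_num) (min_le_left _ _)⟩

lemma iterate_Phi_mem_Icc {V : Fin N → ℝ} (hV : ∀ k, V k ∈ Set.Icc (-1 : ℝ) 1) (n : ℕ)
    (k : Fin N) : (Phi h ε)^[n] V k ∈ Set.Icc (-1 : ℝ) 1 := by
  cases n with
  | zero => exact hV k
  | succ n =>
    rw [Function.iterate_succ_apply']
    exact Phi_mem_Icc _ k

lemma Phi_eq_add_of_mem_Ioo {V : Fin N → ℝ} {k : Fin N}
    (hk : Phi h ε V k ∈ Set.Ioo (-1 : ℝ) 1) : Phi h ε V k = V k + h * localMean ε V k := by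
  rw [← w_eq_add_localMean]
  simp only [Phi, Set.mem_Ioo] at hk ⊢
  grind

lemma J_neg (V : Fin N → ℝ) (k : Fin N) : J ε (-V) k = J ε V k := by
  ext l
  rw [mem_J, mem_J, Pi.neg_apply, Pi.neg_apply, ← abs_neg (V l - V k)]
  ring_nf

lemma Phi_neg (V : Fin N → ℝ) : Phi h ε (-V) = -Phi h ε V := by
  ext k
  have : w h ε (-V) k = -w h ε V k := by
    simp only [w, J_neg, Pi.neg_apply, Finset.sum_neg_distrib]
    ring
  simp only [Phi, this, Pi.neg_apply]
  grind

lemma iterate_Phi_neg (V : Fin N → ℝ) (n : ℕ) : (Phi h ε)^[n] (-V) = -(Phi h ε)^[n] V := by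
  induction n with
  | zero => rfl
  | succ n ih => rw [Function.iterate_succ_apply', ih, Phi_neg, Function.iterate_succ_apply']

lemma min_le_Phi (hh : 0 ≤ h) (hε : 0 ≤ ε) {V : Fin N → ℝ} {k : Fin N} (hk : ε ≤ V k) :
    min 1 ((1 + h / N) * V k) ≤ Phi h ε V k := by
  refine le_trans ?_ (le_max_right _ _)
  refine min_le_min le_rfl ?_
  have hsum : V k ≤ ∑ l ∈ J ε V k, V l := by
    refine Finset.single_le_sum (f := V) (fun l hl => ?_) (self_mem_J hε V k)
    have := (abs_le.1 (mem_J.1 hl)).1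
    linarith
  have hcard : ((J ε V k).card : ℝ) ≤ N := by
    exact_mod_cast (Finset.card_le_univ _).trans_eq (Fintype.card_fin N)
  have hdiv : h / N ≤ h / (J ε V k).card :=
    div_le_div_of_nonneg_left hh (card_J_pos hε V k) hcard
  have h0 : 0 ≤ h / N := by positivity
  have := mul_le_mul hdiv hsum (hε.trans hk) (h0.trans hdiv)
  unfold w
  linarith

lemma eventually_iterate_Phi_eq_one (hh : 0 < h) (hε : ε ∈ Set.Ioo (0 : ℝ) 1)
    {V : Fin N → ℝ} {k : Fin N} (hk : ε ≤ V k) :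
    ∀ᶠ n in atTop, (Phi h ε)^[n] V k = 1 := by
  obtain ⟨h0, h1⟩ := hε
  have hN : (0 : ℝ) < N := by exact_mod_cast k.pos
  set c := 1 + h / N with hc
  have hc1 : 1 < c := by
    have : 0 < h / N := by positivity
    linarith
  have lower : ∀ n, min 1 (c ^ n * ε) ≤ (Phi h ε)^[n] V k := by
    intro n
    induction n with
    | zero => simpa using Or.inr hk
    | succ n ih =>
      rw [Function.iterate_succ_apply']
      have hge : ε ≤ (Phi h ε)^[n] V k := by
        refine le_trans (le_min h1.le ?_) ih
        exact le_mul_of_one_le_left h0.le (one_le_pow₀ hc1.le)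
      refine le_trans ?_ (min_le_Phi hh.le h0.le hge)
      refine le_min (min_le_left _ _) ?_
      rw [← hc]
      rcases min_le_iff.1 ih with ih | ih
      · refine (min_le_left _ _).trans ?_
        nlinarith
      · refine (min_le_right _ _).trans ?_
        rw [pow_succ', mul_assoc]
        gcongr
  have hT : Tendsto (fun n : ℕ => c ^ n * ε) atTop atTop :=
    (tendsto_pow_atTop_atTop_of_one_lt hc1).atTop_mul_const h0
  filter_upwards [hT.eventually_ge_atTop 1, eventually_ge_atTop 1] with n hn hn1
  obtain ⟨m, rfl⟩ : ∃ m, n = m + 1 := ⟨n - 1, by omega⟩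
  refine le_antisymm ?_ ((le_min le_rfl hn).trans (lower _))
  rw [Function.iterate_succ_apply']
  exact (Phi_mem_Icc _ k).2

lemma eventually_iterate_Phi_eq_one_of_exists (hh : 0 < h) (hε : ε ∈ Set.Ioo (0 : ℝ) 1)
    {V : Fin N → ℝ} {k : Fin N} (hk : ∃ n, ε ≤ (Phi h ε)^[n] V k) :
    ∀ᶠ n in atTop, (Phi h ε)^[n] V k = 1 := by
  obtain ⟨m, hm⟩ := hk
  rw [← Filter.map_add_atTop_eq_nat m, Filter.eventually_map]
  filter_upwards [eventually_iterate_Phi_eq_one hh hε hm] with n hn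
  rwa [Function.iterate_add_apply]

lemma eventually_iterate_Phi_eq_or_abs_lt (hh : 0 < h) (hε : ε ∈ Set.Ioo (0 : ℝ) 1)
    (V : Fin N → ℝ) (k : Fin N) :
    (∀ᶠ n in atTop, (Phi h ε)^[n] V k = 1) ∨ (∀ᶠ n in atTop, (Phi h ε)^[n] V k = -1) ∨
      ∀ n, |(Phi h ε)^[n] V k| < ε := by
  by_cases hpos : ∃ n, ε ≤ (Phi h ε)^[n] V k
  · exact Or.inl (eventually_iterate_Phi_eq_one_of_exists hh hε hpos)
  by_cases hneg : ∃ n, ε ≤ (Phi h ε)^[n] (-V) k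
  · refine Or.inr (Or.inl ?_)
    filter_upwards [eventually_iterate_Phi_eq_one_of_exists hh hε hneg] with n hn
    rw [iterate_Phi_neg, Pi.neg_apply] at hn
    linarith
  · refine Or.inr (Or.inr fun n => ?_)
    push Not at hpos hneg
    have := hneg n
    rw [iterate_Phi_neg, Pi.neg_apply] at this
    exact abs_lt.2 ⟨by linarith, hpos n⟩

lemma Phi_eq_one (hh : 0 < h) (hε : ε ∈ Set.Ioo (0 : ℝ) 1) {V : Fin N → ℝ} {k : Fin N}
    (hk : V k = 1) : Phi h ε V k = 1 := by
  refine le_antisymm (Phi_mem_Icc V k).2 ?_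
  refine le_trans (le_min le_rfl ?_) (min_le_Phi hh.le hε.1.le (hε.2.le.trans_eq hk.symm))
  have : 0 ≤ h / N := by positivity
  rw [hk]
  linarith

lemma Phi_eq_neg_one (hh : 0 < h) (hε : ε ∈ Set.Ioo (0 : ℝ) 1) {V : Fin N → ℝ} {k : Fin N}
    (hk : V k = -1) : Phi h ε V k = -1 := by
  have := Phi_eq_one hh hε (V := -V) (k := k) (by simp [hk])
  rw [Phi_neg, Pi.neg_apply] at this
  linarith

end Operator

section Averaging

variable {ι : Type*} {h : ℝ}

/-- In a bounded system in which every agent drifts along the mean of a fixed neighbourhood,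
the smallest drift is nonpositive. -/
lemma drift_nonpos {G : Finset ι} {K : ι → Finset ι} {x a : ℕ → ι → ℝ} {m : ι} (hh : 0 < h)
    (hK : K m ⊆ G) (hKne : (K m).Nonempty)
    (ha : ∀ n, (K m).card * a n m = ∑ l ∈ K m, x n l)
    (hx : ∀ n, ∀ k ∈ G, x (n + 1) k = x n k + h * a n k)
    (hbd : ∀ n, ∀ k ∈ G, x n k ≤ 1) (hm : ∀ n, ∀ k ∈ G, a n m ≤ a n k) (n : ℕ) :
    a n m ≤ 0 := by
  have hcard : (0 : ℝ) < (K m).card := by exact_mod_cast hKne.card_pos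
  have hstep : ∀ n, (1 + h) * a n m ≤ a (n + 1) m := by
    intro n
    refine le_of_mul_le_mul_left ?_ hcard
    have hsum : ∑ l ∈ K m, x (n + 1) l = (K m).card * a n m + h * ∑ l ∈ K m, a n l := by
      rw [ha, Finset.mul_sum, ← Finset.sum_add_distrib]
      exact Finset.sum_congr rfl fun l hl => hx n l (hK hl)
    have hle : (K m).card * a n m ≤ ∑ l ∈ K m, a n l := by
      simpa using Finset.sum_le_sum fun l hl => hm n l (hK hl)
    rw [ha (n + 1), hsum]
    nlinarith
  have hle1 : ∀ n, a n m ≤ 1 := by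
    intro n
    refine le_of_mul_le_mul_left ?_ hcard
    rw [ha]
    simpa using Finset.sum_le_sum fun l hl => hbd n l (hK hl)
  by_contra! hpos
  have hgrow : ∀ j, (1 + h) ^ j * a n m ≤ a (n + j) m := by
    intro j
    induction j with
    | zero => simp
    | succ j ih =>
      refine le_trans ?_ (hstep (n + j))
      rw [pow_succ', mul_assoc]
      gcongr
  have hT : Tendsto (fun j : ℕ => (1 + h) ^ j * a n m) atTop atTop :=
    (tendsto_pow_atTop_atTop_of_one_lt (by linarith)).atTop_mul_const hpos
  obtain ⟨j, hj⟩ := (hT.eventually_gt_atTop 1).exists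
  linarith [hgrow j, hle1 (n + j)]

lemma exists_tendsto_of_drift {G : Finset ι} {K : ι → Finset ι} {x a : ℕ → ι → ℝ} (hh : 0 < h)
    (hK : ∀ k ∈ G, K k ⊆ G) (hKne : ∀ k ∈ G, (K k).Nonempty)
    (ha : ∀ n, ∀ k ∈ G, (K k).card * a n k = ∑ l ∈ K k, x n l)
    (hx : ∀ n, ∀ k ∈ G, x (n + 1) k = x n k + h * a n k)
    (hbd : ∀ n, ∀ k ∈ G, |x n k| ≤ 1)
    (hmono : ∀ n, ∀ k ∈ G, ∀ l ∈ G, x 0 k ≤ x 0 l → a n k ≤ a n l) :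
    ∀ k ∈ G, ∃ p, Tendsto (fun n => x n k) atTop (nhds p) := by
  intro k hk
  obtain ⟨m, hmG, hm⟩ := G.exists_min_image (x 0) ⟨k, hk⟩
  have hneg : ∀ n, a n m ≤ 0 :=
    drift_nonpos hh (hK m hmG) (hKne m hmG) (fun n => ha n m hmG) hx
      (fun n k hk => (abs_le.1 (hbd n k hk)).2) fun n k hk => hmono n m hmG k hk (hm k hk)
  have hanti : Antitone fun n => x n m := antitone_nat_of_succ_le fun n => by
    nlinarith [hx n m hmG, hneg n]
  have hgap : Monotone fun n => x n k - x n m := monotone_nat_of_le_succ fun n => by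
    have := hmono n m hmG k hk (hm k hk)
    nlinarith [hx n m hmG, hx n k hk]
  have h₁ := tendsto_atTop_ciInf hanti
    ⟨-1, by rintro _ ⟨n, rfl⟩; exact (abs_le.1 (hbd n m hmG)).1⟩
  have h₂ := tendsto_atTop_ciSup hgap
    ⟨2, by
      rintro _ ⟨n, rfl⟩
      have := abs_le.1 (hbd n m hmG)
      have := abs_le.1 (hbd n k hk)
      dsimp only
      linarith⟩
  exact ⟨_, (h₁.add h₂).congr fun n => by ring⟩

end Averaging

lemma tendsto_rho_zero {N : ℕ} {u : ℕ → Fin N → ℝ} {P : Fin N → ℝ}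
    (hu : ∀ k, Tendsto (fun n => u n k) atTop (nhds (P k))) :
    Tendsto (fun n => rho (u n) P) atTop (nhds 0) := by
  have hsum : Tendsto (fun n => ∑ k, |u n k - P k|) atTop (nhds 0) := by
    have := tendsto_finsetSum Finset.univ fun k _ => ((hu k).sub_const (P k)).abs
    simpa using this
  refine squeeze_zero (fun n => Real.iSup_nonneg fun k => abs_nonneg _) (fun n => ?_) hsum
  refine Real.iSup_le (fun k => ?_) (Finset.sum_nonneg fun k _ => abs_nonneg _)
  exact Finset.single_le_sum (f := fun k => |u n k - P k|) (fun k _ => abs_nonneg _)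
    (Finset.mem_univ k)

section Trapped

variable {N : ℕ} {h ε : ℝ} {u : ℕ → Fin N → ℝ} {G : Finset (Fin N)}

lemma add_localMean_of_abs_lt (hε : ε ∈ Set.Ioo (0 : ℝ) 1)
    (hu : ∀ n, u (n + 1) = Phi h ε (u n)) {k : Fin N} (hk : ∀ n, |u n k| < ε) (n : ℕ) :
    u (n + 1) k = u n k + h * localMean ε (u n) k := by
  have := abs_lt.1 (hk (n + 1))
  rw [hu] at this ⊢
  exact Phi_eq_add_of_mem_Ioo ⟨by linarith [hε.2], by linarith [hε.2]⟩

/-- While the agents of `G` stay away from `±1`, the distances between them do not decrease. -/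
lemma monotone_abs_sub (hh : 0 < h) (hε : ε ∈ Set.Ioo (0 : ℝ) 1)
    (hu : ∀ n, u (n + 1) = Phi h ε (u n)) (hG : ∀ k ∈ G, ∀ n, |u n k| < ε)
    {k l : Fin N} (hk : k ∈ G) (hl : l ∈ G) : Monotone fun n => |u n l - u n k| := by
  refine monotone_nat_of_le_succ fun n => ?_
  rw [add_localMean_of_abs_lt hε hu (hG k hk), add_localMean_of_abs_lt hε hu (hG l hl)]
  rcases le_total (u n k) (u n l) with hle | hle
  · have := mul_le_mul_of_nonneg_left (localMean_le_localMean hε.1.le hle) hh.le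
    rw [abs_of_nonneg (by linarith), abs_of_nonneg (by linarith)]
    linarith
  · have := mul_le_mul_of_nonneg_left (localMean_le_localMean hε.1.le hle) hh.le
    rw [abs_of_nonpos (by linarith), abs_of_nonpos (by linarith)]
    linarith

end Trapped

/-- If every distance to the agent `k` is eventually large or monotone, then its neighbourhood is
eventually constant. -/
lemma exists_eventually_J_eq {N : ℕ} {ε : ℝ} {u : ℕ → Fin N → ℝ} (k : Fin N)
    (hJ : ∀ l, (∀ᶠ n in atTop, l ∉ J ε (u n) k) ∨ Monotone fun n => |u n l - u n k|) :
    ∃ K : Finset (Fin N), ∀ᶠ n in atTop, J ε (u n) k = K := by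
  classical
  refine ⟨Finset.univ.filter fun l => ∀ᶠ n in atTop, l ∈ J ε (u n) k, ?_⟩
  have hdich : ∀ l, (∀ᶠ n in atTop, l ∈ J ε (u n) k) ∨ ∀ᶠ n in atTop, l ∉ J ε (u n) k := by
    intro l
    rcases hJ l with hl | hl
    · exact Or.inr hl
    by_cases hall : ∀ n, l ∈ J ε (u n) k
    · exact Or.inl (Eventually.of_forall hall)
    · push Not at hall
      obtain ⟨m, hm⟩ := hall
      refine Or.inr ?_
      filter_upwards [eventually_ge_atTop m] with n hn
      rw [mem_J, not_le] at hm ⊢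
      exact hm.trans_le (hl hn)
  have hiff : ∀ l, ∀ᶠ n in atTop, l ∈ J ε (u n) k ↔ ∀ᶠ n in atTop, l ∈ J ε (u n) k := by
    intro l
    rcases hdich l with hl | hl
    · filter_upwards [hl] with n hn
      exact iff_of_true hn hl
    · filter_upwards [hl] with n hn
      refine iff_of_false hn fun hl' => ?_
      obtain ⟨m, hm, hm'⟩ := (hl.and hl').exists
      exact hm hm'
  filter_upwards [eventually_all.2 hiff] with n hn
  ext l
  simpa using hn l

/-- Theorem 4: if `ε ≤ 1/2`, then for every nondecreasing
`V⁰ ∈ 𝒱` the trajectory `Φⁿ(V⁰)` tends, as `n → ∞`, to a fixed point of `Φ`. -/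
theorem statement12 (N : ℕ) (hN : 1 ≤ N) (h ε : ℝ)
    (hh : h ∈ Set.Ioo (0 : ℝ) 1) (hε : ε ∈ Set.Ioo (0 : ℝ) 1)
    (hε2 : ε ≤ 1 / 2)
    (V0 : Fin N → ℝ) (hV0 : ∀ k, V0 k ∈ Set.Icc (-1 : ℝ) 1) (hmono : Monotone V0) :
    ∃ P : Fin N → ℝ, (∀ k, P k ∈ Set.Icc (-1 : ℝ) 1) ∧ Phi h ε P = P ∧
      Filter.Tendsto (fun n => rho ((Phi h ε)^[n] V0) P) Filter.atTop (nhds 0) := by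
  obtain ⟨hh0, -⟩ := hh
  have hε0 := hε.1
  classical
  set u : ℕ → Fin N → ℝ := fun n => (Phi h ε)^[n] V0 with hu
  have hsucc : ∀ n, u (n + 1) = Phi h ε (u n) := fun n => Function.iterate_succ_apply' _ _ _
  set G : Finset (Fin N) := Finset.univ.filter fun k => ∀ n, |u n k| < ε with hGdef
  have hG : ∀ k ∈ G, ∀ n, |u n k| < ε := fun k hk => (Finset.mem_filter.1 hk).2
  have hcases : ∀ k, (∀ᶠ n in atTop, u n k = 1) ∨ (∀ᶠ n in atTop, u n k = -1) ∨ k ∈ G := by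
    intro k
    simpa [hGdef] using eventually_iterate_Phi_eq_or_abs_lt hh0 hε V0 k
  have hout : ∀ l ∉ G, ∀ᶠ n in atTop, |u n l| = 1 := by
    intro l hl
    rcases hcases l with h1 | h1 | h1
    · filter_upwards [h1] with n hn
      simp [hn]
    · filter_upwards [h1] with n hn
      simp [hn]
    · exact absurd h1 hl
  have hfar : ∀ k ∈ G, ∀ l ∉ G, ∀ᶠ n in atTop, l ∉ J ε (u n) k := by
    intro k hk l hl
    filter_upwards [hout l hl] with n hn
    rw [mem_J, not_le]
    linarith [abs_sub_abs_le_abs_sub (u n l) (u n k), hG k hk n]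
  have hdist : ∀ k ∈ G, ∀ l ∈ G, Monotone fun n => |u n l - u n k| :=
    fun k hk l hl => monotone_abs_sub hh0 hε hsucc hG hk hl
  have hdrift : ∀ k ∈ G, ∀ n, u (n + 1) k = u n k + h * localMean ε (u n) k :=
    fun k hk => add_localMean_of_abs_lt hε hsucc (hG k hk)
  have hexK : ∀ k, ∃ K : Finset (Fin N), k ∈ G → ∀ᶠ n in atTop, J ε (u n) k = K := by
    intro k
    by_cases hk : k ∈ G
    · obtain ⟨K, hK⟩ := exists_eventually_J_eq (ε := ε) (u := u) k fun l => by
        by_cases hl : l ∈ G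
        · exact Or.inr (hdist k hk l hl)
        · exact Or.inl (hfar k hk l hl)
      exact ⟨K, fun _ => hK⟩
    · exact ⟨∅, fun hk' => absurd hk' hk⟩
  choose K hK using hexK
  have hKG : ∀ k ∈ G, K k ⊆ G := by
    intro k hk l hl
    by_contra hlG
    obtain ⟨n, hn, hn'⟩ := ((hK k hk).and (hfar k hk l hlG)).exists
    exact hn' (hn ▸ hl)
  have hself : ∀ k ∈ G, k ∈ K k := by
    intro k hk
    obtain ⟨n, hn⟩ := (hK k hk).exists
    exact hn ▸ self_mem_J hε0.le (u n) k
  have hmean : ∀ n k, J ε (u n) k = K k →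
      (K k).card * localMean ε (u n) k = ∑ l ∈ K k, u n l := by
    intro n k hn
    rw [localMean, ← hn, mul_div_cancel₀ _ (card_J_pos hε0.le (u n) k).ne']
  obtain ⟨T, hT⟩ := ((Finset.eventually_all G).2 hK).exists_forall_of_atTop
  have hlimG : ∀ k ∈ G, ∃ p, Tendsto (fun n => u (n + T) k) atTop (nhds p) :=
    exists_tendsto_of_drift (x := fun n => u (n + T))
      (a := fun n => localMean ε (u (n + T))) hh0 hKG (fun k hk => ⟨k, hself k hk⟩)
      (fun n k hk => hmean _ _ (hT _ (Nat.le_add_left T n) k hk))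
      (fun n k hk => by
        rw [Nat.add_right_comm]
        exact hdrift k hk (n + T))
      (fun n k hk => ((hG k hk _).trans hε.2).le)
      (fun n k _ l _ hkl => by
        refine localMean_le_localMean hε0.le ?_
        have := iterate_Phi_le_iterate_Phi hh0.le hε0.le hkl n
        simpa only [hu, zero_add, ← Function.iterate_add_apply] using this)
  have hlim : ∀ k, ∃ p, Tendsto (fun n => u n k) atTop (nhds p) := by
    intro k
    rcases hcases k with h1 | h1 | h1
    · exact ⟨1, tendsto_const_nhds.congr' (h1.mono fun n hn => hn.symm)⟩
    · exact ⟨-1, tendsto_const_nhds.congr' (h1.mono fun n hn => hn.symm)⟩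
    · obtain ⟨p, hp⟩ := hlimG k h1
      exact ⟨p, (tendsto_add_atTop_iff_nat (f := fun n => u n k) T).1 hp⟩
  choose P hP using hlim
  refine ⟨P, fun k => ?_, ?_, tendsto_rho_zero hP⟩
  · exact isClosed_Icc.mem_of_tendsto (hP k)
      (Eventually.of_forall fun n => iterate_Phi_mem_Icc hV0 n k)
  ext k
  rcases hcases k with h1 | h1 | hk
  · have hPk : P k = 1 :=
      tendsto_nhds_unique (hP k) (tendsto_const_nhds.congr' (h1.mono fun n hn => hn.symm))
    rw [Phi_eq_one hh0 hε hPk, hPk]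
  · have hPk : P k = -1 :=
      tendsto_nhds_unique (hP k) (tendsto_const_nhds.congr' (h1.mono fun n hn => hn.symm))
    rw [Phi_eq_neg_one hh0 hε hPk, hPk]
  have hsum : ∑ l ∈ K k, P l = 0 := by
    refine tendsto_nhds_unique (tendsto_finsetSum (K k) fun l _ => hP l) ?_
    have h₁ : Tendsto (fun n => (K k).card * ((u (n + 1) k - u n k) / h)) atTop (nhds 0) := by
      have := (((tendsto_add_atTop_iff_nat 1).2 (hP k)).sub (hP k)).div_const h
      simpa using this.const_mul ((K k).card : ℝ)
    refine h₁.congr' ?_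
    filter_upwards [hK k hk] with n hn
    rw [← hmean n k hn, hdrift k hk n, add_sub_cancel_left, mul_div_cancel_left₀ _ hh0.ne']
  have hclose : ∀ l ∈ K k, |P l - P k| ≤ ε := by
    intro l hl
    refine le_of_tendsto ((hP l).sub (hP k)).abs ?_
    filter_upwards [hK k hk] with n hn
    exact mem_J.1 (hn ▸ hl)
  have hPle : |P k| ≤ ε :=
    le_of_tendsto (hP k).abs (Eventually.of_forall fun n => (hG k hk n).le)
  have hPlt : |P k| < ε := by
    refine lt_of_le_of_ne hPle fun heq => ?_
    rcases (abs_eq hε0.le).1 heq with hPk | hPk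
    · have := Finset.single_le_sum (f := P)
        (fun l hl => by linarith [(abs_le.1 (hclose l hl)).1]) (hself k hk)
      linarith
    · have := Finset.single_le_sum (f := fun l => -P l)
        (fun l hl => by linarith [(abs_le.1 (hclose l hl)).2]) (hself k hk)
      simp only [Finset.sum_neg_distrib] at this
      linarith
  have hJP : J ε P k = K k := by
    ext l
    rw [mem_J]
    refine ⟨fun hl => ?_, hclose l⟩
    by_cases hlG : l ∈ G
    · obtain ⟨n, hn⟩ := (hK k hk).exists
      rw [← hn, mem_J]
      exact ((hdist k hk l hlG).ge_of_tendsto ((hP l).sub (hP k)).abs n).trans hl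
    · have hPl : |P l| = 1 := tendsto_nhds_unique (hP l).abs
        (tendsto_const_nhds.congr' ((hout l hlG).mono fun n hn => hn.symm))
      linarith [abs_sub_abs_le_abs_sub (P l) (P k)]
  have hw : w h ε P k = P k := by
    rw [w, hJP, hsum, mul_zero, add_zero]
  obtain ⟨hlow, hupp⟩ := abs_lt.1 hPlt
  rw [Phi, hw, min_eq_right (by linarith [hε.2]), max_eq_right (by linarith [hε.2])]
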